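/- arXiv:1912.07903 — 10 statements merged into one kernel-verified Lean document; each statement's English description precedes it below -/
import Mathlib

section
/- Let ζ^k (k∈ℕ) and ζ be complex sequences in h^{1/2}_+ with ‖ζ^k − ζ‖_{h^{1/2}} → 0 as k→∞. Then for every integer n≥1, ω_n^{(4)}(ζ^k) → ω_n^{(4)}(ζ) as k→∞. -/
/-- The frequencies `ω_n^{(4)}` of the third-order Benjamin–Ono equation, in terms of
the actions `γ_p` (indexed by `p ≥ 1`; terms with index `0` carry a zero factor, so
summing over `ℕ` is the same as summing over indices `≥ 1`):
`ω_n^{(4)}(γ) = n³ + n ∑_{p≥1} p γ_p − 3 ∑_{p≥1} min(p,n)² γ_p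
  + 3 ∑_{p,q≥1} min(p,q,n) γ_p γ_q`. -/
noncomputable def omega4 (γ : ℕ → ℝ) (n : ℕ) : ℝ :=
  (n : ℝ) ^ 3 + (n : ℝ) * (∑' p : ℕ, (p : ℝ) * γ p)
    - 3 * (∑' p : ℕ, ((min p n : ℕ) : ℝ) ^ 2 * γ p)
    + 3 * (∑' pq : ℕ × ℕ, ((min (min pq.1 pq.2) n : ℕ) : ℝ) * γ pq.1 * γ pq.2)

open Filter Topology

theorem tendsto_tsum_of_abs_sub_le {ι : Type*} {f : ℕ → ι → ℝ} {g : ι → ℝ} {d : ℕ → ι → ℝ}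
    (hg : Summable g) (hd : ∀ k, Summable (d k)) (hfd : ∀ k i, |f k i - g i| ≤ d k i)
    (hlim : Tendsto (fun k => ∑' i, d k i) atTop (𝓝 0)) :
    Tendsto (fun k => ∑' i, f k i) atTop (𝓝 (∑' i, g i)) := by
  rw [tendsto_iff_norm_sub_tendsto_zero]
  refine squeeze_zero (fun _ => norm_nonneg _) (fun k => ?_) hlim
  have hsub : Summable fun i => f k i - g i :=
    Summable.of_norm_bounded (hd k) fun i => hfd k i
  have hf : Summable (f k) := by simpa using hsub.add hg
  rw [← hf.tsum_sub hg]
  exact tsum_of_norm_bounded (hd k).hasSum fun i => hfd k i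

theorem abs_norm_sq_sub_norm_sq_le {E : Type*} [SeminormedAddCommGroup E] (x y : E) {ε : ℝ}
    (hε : 0 < ε) :
    |‖x‖ ^ 2 - ‖y‖ ^ 2| ≤ (1 + ε⁻¹) * ‖x - y‖ ^ 2 + ε * ‖y‖ ^ 2 := by
  have hxy : |‖x‖ - ‖y‖| ≤ ‖x - y‖ := abs_norm_sub_norm_le x y
  have hyoung : 2 * (‖x - y‖ * ‖y‖) ≤ ε⁻¹ * ‖x - y‖ ^ 2 + ε * ‖y‖ ^ 2 := by
    have h : 0 ≤ ε⁻¹ * (‖x - y‖ - ε * ‖y‖) ^ 2 := by positivity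
    have e : ε⁻¹ * (‖x - y‖ - ε * ‖y‖) ^ 2
        = ε⁻¹ * ‖x - y‖ ^ 2 + ε * ‖y‖ ^ 2 - 2 * (‖x - y‖ * ‖y‖) := by
      field_simp
      ring
    linarith
  have hsum : ‖x‖ + ‖y‖ ≤ ‖x - y‖ + 2 * ‖y‖ := by linarith [(abs_le.1 hxy).2]
  calc |‖x‖ ^ 2 - ‖y‖ ^ 2| = |‖x‖ - ‖y‖| * (‖x‖ + ‖y‖) := by
        rw [sq_sub_sq, abs_mul, abs_of_nonneg (by positivity : 0 ≤ ‖x‖ + ‖y‖), mul_comm]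
    _ ≤ ‖x - y‖ * (‖x - y‖ + 2 * ‖y‖) := by gcongr
    _ ≤ _ := by nlinarith

theorem summable_weight_mul_norm_sub_sq {ι E : Type*} [SeminormedAddCommGroup E]
    {w : ι → ℝ} (hw : ∀ i, 0 ≤ w i) {x y : ι → E}
    (hx : Summable fun i => w i * ‖x i‖ ^ 2) (hy : Summable fun i => w i * ‖y i‖ ^ 2) :
    Summable fun i => w i * ‖x i - y i‖ ^ 2 := by
  refine Summable.of_nonneg_of_le (fun i => mul_nonneg (hw i) (sq_nonneg _)) (fun i => ?_)
    ((hx.add hy).mul_left 2)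
  have h : ‖x i - y i‖ ^ 2 ≤ 2 * (‖x i‖ ^ 2 + ‖y i‖ ^ 2) := by
    nlinarith [norm_sub_le (x i) (y i), norm_nonneg (x i - y i), sq_nonneg (‖x i‖ - ‖y i‖)]
  nlinarith [mul_le_mul_of_nonneg_left h (hw i)]

theorem tendsto_tsum_abs_weight_mul_norm_sq_sub {ι E : Type*} [SeminormedAddCommGroup E]
    {w : ι → ℝ} (hw : ∀ i, 0 ≤ w i) {x : ℕ → ι → E} {y : ι → E}
    (hx : ∀ k, Summable fun i => w i * ‖x k i‖ ^ 2) (hy : Summable fun i => w i * ‖y i‖ ^ 2)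
    (hlim : Tendsto (fun k => ∑' i, w i * ‖x k i - y i‖ ^ 2) atTop (𝓝 0)) :
    Tendsto (fun k => ∑' i, |w i * ‖x k i‖ ^ 2 - w i * ‖y i‖ ^ 2|) atTop (𝓝 0) := by
  set A := ∑' i, w i * ‖y i‖ ^ 2
  have hA : 0 ≤ A := tsum_nonneg fun i => mul_nonneg (hw i) (sq_nonneg _)
  have hbound (k : ℕ) {ε : ℝ} (hε : 0 < ε) :
      ∑' i, |w i * ‖x k i‖ ^ 2 - w i * ‖y i‖ ^ 2|
        ≤ (1 + ε⁻¹) * ∑' i, w i * ‖x k i - y i‖ ^ 2 + ε * A := by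
    have hS := summable_weight_mul_norm_sub_sq hw (hx k) hy
    rw [← tsum_mul_left, ← tsum_mul_left, ← (hS.mul_left _).tsum_add (hy.mul_left _)]
    refine ((hx k).sub hy).abs.tsum_le_tsum (fun i => ?_) ((hS.mul_left _).add (hy.mul_left _))
    rw [← mul_sub, abs_mul, abs_of_nonneg (hw i)]
    calc _ ≤ w i * ((1 + ε⁻¹) * ‖x k i - y i‖ ^ 2 + ε * ‖y i‖ ^ 2) :=
          mul_le_mul_of_nonneg_left (abs_norm_sq_sub_norm_sq_le _ _ hε) (hw i)
      _ = _ := by ring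
  refine tendsto_order.2 ⟨fun b hb => Eventually.of_forall fun k =>
    hb.trans_le (tsum_nonneg fun _ => abs_nonneg _), fun b hb => ?_⟩
  have hε : 0 < b / (A + 1) := by positivity
  have hεA : b / (A + 1) * A < b := by
    rw [div_mul_eq_mul_div, div_lt_iff₀ (by positivity)]
    nlinarith
  have hlim' := (hlim.const_mul (1 + (b / (A + 1))⁻¹)).add_const (b / (A + 1) * A)
  rw [mul_zero, zero_add] at hlim'
  filter_upwards [hlim'.eventually_lt_const hεA] with k hk
  exact (hbound k hε).trans_lt hk

theorem tendsto_tsum_mul_of_abs_le {ι : Type*} {a : ℕ → ι → ℝ} {b c : ι → ℝ} {C : ℝ}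
    (ha : ∀ k, Summable (a k)) (hb : Summable b) (hc : ∀ i, |c i| ≤ C)
    (hlim : Tendsto (fun k => ∑' i, |a k i - b i|) atTop (𝓝 0)) :
    Tendsto (fun k => ∑' i, c i * a k i) atTop (𝓝 (∑' i, c i * b i)) := by
  refine tendsto_tsum_of_abs_sub_le (d := fun k i => C * |a k i - b i|) ?_
    (fun k => ((ha k).sub hb).abs.mul_left C) (fun k i => ?_) ?_
  · refine Summable.of_norm_bounded (hb.abs.mul_left C) fun i => ?_
    rw [Real.norm_eq_abs, abs_mul]
    gcongr
    exact hc i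
  · rw [← mul_sub, abs_mul]
    gcongr
    exact hc i
  · simpa [tsum_mul_left] using hlim.const_mul C

theorem tendsto_tsum_abs_mul_sub_mul {ι : Type*} {a : ℕ → ι → ℝ} {b : ι → ℝ}
    (ha : ∀ k, Summable (a k)) (hb : Summable b)
    (hlim : Tendsto (fun k => ∑' i, |a k i - b i|) atTop (𝓝 0)) :
    Tendsto (fun k => ∑' ij : ι × ι, |a k ij.1 * a k ij.2 - b ij.1 * b ij.2|) atTop (𝓝 0) := by
  have hd (k : ℕ) : Summable fun i => |a k i - b i| := ((ha k).sub hb).abs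
  have hprod {f g : ι → ℝ} (hf : Summable f) (hg : Summable g) :
      Summable fun ij : ι × ι => f ij.1 * g ij.2 := summable_mul_of_summable_norm hf.norm hg.norm
  have habs : Tendsto (fun k => ∑' i, |a k i|) atTop (𝓝 (∑' i, |b i|)) :=
    tendsto_tsum_of_abs_sub_le hb.abs hd (fun _ _ => abs_abs_sub_abs_le _ _) hlim
  have hbound := (hlim.mul habs).add (hlim.const_mul (∑' i, |b i|))
  rw [zero_mul, mul_zero, add_zero] at hbound
  refine squeeze_zero (fun _ => tsum_nonneg fun _ => abs_nonneg _) (fun k => ?_) hbound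
  have h1 := hprod (hd k) (ha k).abs
  have h2 := hprod hb.abs (hd k)
  rw [tsum_mul_tsum_of_summable_norm (hd k).norm (ha k).abs.norm,
    tsum_mul_tsum_of_summable_norm hb.abs.norm (hd k).norm, ← h1.tsum_add h2]
  refine ((hprod (ha k) (ha k)).sub (hprod hb hb)).abs.tsum_le_tsum (fun ij => ?_) (h1.add h2)
  rw [← abs_mul, ← abs_mul]
  refine le_trans (le_of_eq ?_) (abs_add_le _ _)
  ring_nf

/-- if `ζ^k → ζ` in `h^{1/2}_+`, then `ω_n^{(4)}(ζ^k) → ω_n^{(4)}(ζ)`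
for every `n ≥ 1`. -/
theorem tendsto_omega4_of_h_half_tendsto (ζk : ℕ → ℕ → ℂ) (ζ : ℕ → ℂ)
    (hζ : Summable fun n : ℕ => (n : ℝ) * ‖ζ n‖ ^ 2)
    (hζk : ∀ k, Summable fun n : ℕ => (n : ℝ) * ‖ζk k n‖ ^ 2)
    (hconv : Filter.Tendsto (fun k => ∑' n : ℕ, (n : ℝ) * ‖ζk k n - ζ n‖ ^ 2)
      Filter.atTop (nhds 0))
    (n : ℕ) (hn : 1 ≤ n) :
    Filter.Tendsto (fun k => omega4 (fun m => ‖ζk k m‖ ^ 2) n) Filter.atTop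
      (nhds (omega4 (fun m => ‖ζ m‖ ^ 2) n)) := by
  have hmin_sq (p : ℕ) (t : ℝ) :
      ((min p n : ℕ) : ℝ) ^ 2 * t = ((min p n : ℕ) : ℝ) ^ 2 / p * (p * t) := by
    rcases eq_or_ne p 0 with rfl | hp
    · simp
    · field_simp
  have hmin_sq_le (p : ℕ) : |((min p n : ℕ) : ℝ) ^ 2 / p| ≤ n := by
    rw [abs_of_nonneg (by positivity)]
    refine div_le_of_le_mul₀ (by positivity) (by positivity) ?_
    rw [sq]
    gcongr
    · exact min_le_right _ _
    · exact min_le_left _ _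
  have hmin (p q : ℕ) (s t : ℝ) : ((min (min p q) n : ℕ) : ℝ) * s * t
      = ((min (min p q) n : ℕ) : ℝ) / (p * q) * ((p * s) * (q * t)) := by
    rcases eq_or_ne p 0 with rfl | hp
    · simp
    rcases eq_or_ne q 0 with rfl | hq
    · simp
    field_simp
  have hmin_le (p q : ℕ) : |((min (min p q) n : ℕ) : ℝ) / (p * q)| ≤ 1 := by
    rw [abs_of_nonneg (by positivity)]
    refine div_le_of_le_mul₀ (by positivity) zero_le_one ?_
    rw [one_mul]
    norm_cast
    rcases Nat.eq_zero_or_pos q with rfl | hq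
    · simp
    · exact (min_le_left _ _).trans ((min_le_left _ _).trans (Nat.le_mul_of_pos_right p hq))
  have hlim := tendsto_tsum_abs_weight_mul_norm_sq_sub (fun p : ℕ => p.cast_nonneg) hζk hζ hconv
  have hprod {f : ℕ → ℝ} (hf : Summable f) : Summable fun pq : ℕ × ℕ => f pq.1 * f pq.2 :=
    summable_mul_of_summable_norm hf.norm hf.norm
  have hlin := tendsto_tsum_of_abs_sub_le hζ (fun k => ((hζk k).sub hζ).abs)
    (fun _ _ => le_rfl) hlim
  have hquad := tendsto_tsum_mul_of_abs_le hζk hζ hmin_sq_le hlim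
  have hdouble := tendsto_tsum_mul_of_abs_le (fun k => hprod (hζk k)) (hprod hζ)
    (fun pq : ℕ × ℕ => hmin_le pq.1 pq.2) (tendsto_tsum_abs_mul_sub_mul hζk hζ hlim)
  simp only [omega4, hmin_sq, hmin]
  exact ((tendsto_const_nhds.add (hlin.const_mul _)).sub (hquad.const_mul 3)).add
    (hdouble.const_mul 3)
end

section
/- Let γ=(γ_p)_{p≥1} be nonnegative reals with ∑_{p≥1} p γ_p < ∞, and let α>0. For each integer k≥1 define γ^k by γ^k_p = γ_p for p≠k and γ^k_k = γ_k + α/k. Then for every integer n≥1, ω_n^{(4)}(γ^k) → ω_n^{(4)}(γ) + nα as k→∞. Consequently, if t∈ℝ satisfies nαt ∉ 2πℤ and z∈ℂ is nonzero, the sequence (z·e^{i ω_n^{(4)}(γ^k) t})_k converges to z·e^{i(ω_n^{(4)}(γ)+nα)t}, which is different from z·e^{i ω_n^{(4)}(γ) t}. -/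
theorem update_add_eq_add_single (γ : ℕ → ℝ) (k : ℕ) (ε : ℝ) :
    Function.update γ k (γ k + ε) = γ + Pi.single k ε := by
  ext p
  by_cases h : p = k
  · subst h; simp
  · simp [h]

theorem tsum_mul_update_add {c γ : ℕ → ℝ} (h : Summable fun p => c p * γ p) (k : ℕ) (ε : ℝ) :
    ∑' p, c p * Function.update γ k (γ k + ε) p = ∑' p, c p * γ p + c k * ε := by
  have hs : HasSum (fun p => c p * (Pi.single k ε : ℕ → ℝ) p) (c k * ε) := by
    convert hasSum_single (f := fun p => c p * (Pi.single k ε : ℕ → ℝ) p) k ?_ using 1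
    · simp
    · intro p hp
      simp [hp]
  rw [← (h.hasSum.add hs).tsum_eq, update_add_eq_add_single]
  simp only [Pi.add_apply, mul_add]

theorem Summable.bounded_mul {ι : Type*} {f c : ι → ℝ} {C : ℝ} (hf : Summable f)
    (hf0 : ∀ i, 0 ≤ f i) (hc : ∀ i, |c i| ≤ C) : Summable fun i => c i * f i := by
  refine Summable.of_norm_bounded (hf.mul_left C) fun i => ?_
  rw [Real.norm_eq_abs, abs_mul, abs_of_nonneg (hf0 i)]
  exact mul_le_mul_of_nonneg_right (hc i) (hf0 i)

theorem tsum_prod_mul_update_add {c : ℕ × ℕ → ℝ} {γ : ℕ → ℝ} {C : ℝ} (hγ : ∀ p, 0 ≤ γ p)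
    (hs : Summable γ) (hc : ∀ x, |c x| ≤ C) (k : ℕ) (ε : ℝ) :
    ∑' x : ℕ × ℕ, c x * Function.update γ k (γ k + ε) x.1 * Function.update γ k (γ k + ε) x.2 =
      ∑' x : ℕ × ℕ, c x * γ x.1 * γ x.2 +
        (ε * ∑' q, c (k, q) * γ q + ε * ∑' p, c (p, k) * γ p + ε ^ 2 * c (k, k)) := by
  have h₀ : Summable fun x : ℕ × ℕ => c x * γ x.1 * γ x.2 := by
    simpa only [mul_assoc] using (hs.mul_of_nonneg hs hγ hγ).bounded_mul
      (fun x => mul_nonneg (hγ x.1) (hγ x.2)) hc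
  have h₁ : HasSum (fun x : ℕ × ℕ => c x * (Pi.single k ε : ℕ → ℝ) x.1 * γ x.2)
      (ε * ∑' q, c (k, q) * γ q) := by
    rw [← Function.Injective.hasSum_iff (Prod.mk_right_injective k)]
    · refine ((hs.bounded_mul hγ fun q => hc (k, q)).hasSum.mul_left ε).congr_fun fun q => ?_
      simp only [Function.comp_apply, Pi.single_eq_same]
      ring
    · rintro ⟨p, q⟩ hx
      have : p ≠ k := by rintro rfl; exact hx ⟨q, rfl⟩
      simp [this]
  have h₂ : HasSum (fun x : ℕ × ℕ => c x * γ x.1 * (Pi.single k ε : ℕ → ℝ) x.2)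
      (ε * ∑' p, c (p, k) * γ p) := by
    rw [← Function.Injective.hasSum_iff (Prod.mk_left_injective k)]
    · refine ((hs.bounded_mul hγ fun p => hc (p, k)).hasSum.mul_left ε).congr_fun fun p => ?_
      simp only [Function.comp_apply, Pi.single_eq_same]
      ring
    · rintro ⟨p, q⟩ hx
      have : q ≠ k := by rintro rfl; exact hx ⟨p, rfl⟩
      simp [this]
  have h₃ : HasSum (fun x : ℕ × ℕ =>
      c x * (Pi.single k ε : ℕ → ℝ) x.1 * (Pi.single k ε : ℕ → ℝ) x.2) (ε ^ 2 * c (k, k)) := by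
    convert hasSum_single (f := fun x : ℕ × ℕ =>
      c x * (Pi.single k ε : ℕ → ℝ) x.1 * (Pi.single k ε : ℕ → ℝ) x.2) (k, k) ?_ using 1
    · simp
      ring
    · rintro ⟨p, q⟩ hx
      by_cases hp : p = k
      · have : q ≠ k := by rintro rfl; exact hx (by rw [hp])
        simp [this]
      · simp [hp]
  rw [← (h₀.hasSum.add ((h₁.add h₂).add h₃)).tsum_eq, update_add_eq_add_single]
  refine tsum_congr fun x => ?_
  simp only [Pi.add_apply]
  ring

theorem summable_of_summable_natCast_mul {γ : ℕ → ℝ} (hγ : ∀ p, 0 ≤ γ p)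
    (h : Summable fun p : ℕ => (p : ℝ) * γ p) : Summable γ := by
  rw [← summable_nat_add_iff 1] at h ⊢
  refine Summable.of_nonneg_of_le (fun p => hγ _) (fun p => ?_) h
  refine le_mul_of_one_le_left (hγ _) ?_
  exact_mod_cast Nat.le_add_left 1 p

theorem abs_tsum_bounded_mul_le {ι : Type*} {f c : ι → ℝ} {C : ℝ} (hf : Summable f)
    (hf0 : ∀ i, 0 ≤ f i) (hc : ∀ i, |c i| ≤ C) : |∑' i, c i * f i| ≤ C * ∑' i, f i := by
  rw [← Real.norm_eq_abs]
  refine tsum_of_norm_bounded (hf.hasSum.mul_left C) fun i => ?_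
  rw [Real.norm_eq_abs, abs_mul, abs_of_nonneg (hf0 i)]
  exact mul_le_mul_of_nonneg_right (hc i) (hf0 i)

theorem tendsto_mul_zero_of_abs_le {ε b : ℕ → ℝ} {B : ℝ}
    (hε : Filter.Tendsto ε Filter.atTop (nhds 0)) (hb : ∀ k, |b k| ≤ B) :
    Filter.Tendsto (fun k => ε k * b k) Filter.atTop (nhds 0) :=
  hε.zero_mul_isBoundedUnder_le (Filter.isBoundedUnder_of ⟨B, hb⟩)

theorem tendsto_omega4_update {γ : ℕ → ℝ} (hγ : ∀ p, 0 ≤ γ p)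
    (hsum : Summable fun p : ℕ => (p : ℝ) * γ p) (α : ℝ) (n : ℕ) :
    Filter.Tendsto (fun k : ℕ => omega4 (Function.update γ k (γ k + α / k)) n)
      Filter.atTop (nhds (omega4 γ n + n * α)) := by
  have hs := summable_of_summable_natCast_mul hγ hsum
  have hε : Filter.Tendsto (fun k : ℕ => α / (k : ℝ)) Filter.atTop (nhds 0) :=
    tendsto_const_div_atTop_nhds_zero_nat α
  have hsq (p : ℕ) : |((min p n : ℕ) : ℝ) ^ 2| ≤ (n : ℝ) ^ 2 := by
    rw [abs_of_nonneg (by positivity)]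
    gcongr
    exact min_le_right _ _
  have hc (x : ℕ × ℕ) : |((min (min x.1 x.2) n : ℕ) : ℝ)| ≤ (n : ℝ) := by
    rw [abs_of_nonneg (by positivity)]
    exact_mod_cast min_le_right _ _
  have hs₂ := hs.bounded_mul hγ hsq
  have l₂ := tendsto_mul_zero_of_abs_le hε hsq
  have l₃ := tendsto_mul_zero_of_abs_le hε
    fun k => abs_tsum_bounded_mul_le hs hγ fun q => hc (k, q)
  have l₄ := tendsto_mul_zero_of_abs_le hε
    fun k => abs_tsum_bounded_mul_le hs hγ fun p => hc (p, k)
  have l₅ := tendsto_mul_zero_of_abs_le (by simpa using hε.pow 2) fun k => hc (k, k)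
  have key := (((l₃.add l₄).add l₅).const_mul 3).sub (l₂.const_mul 3) |>.const_add
    (omega4 γ n + n * α)
  simp only [add_zero, mul_zero, sub_zero] at key
  refine key.congr' ?_
  filter_upwards [Filter.eventually_ne_atTop 0] with k hk
  have hk' : (k : ℝ) ≠ 0 := Nat.cast_ne_zero.mpr hk
  have e₁ : (k : ℝ) * (α / k) = α := mul_div_cancel₀ α hk'
  unfold omega4
  rw [tsum_mul_update_add hsum, tsum_mul_update_add hs₂,
    tsum_prod_mul_update_add (c := fun x => ((min (min x.1 x.2) n : ℕ) : ℝ)) hγ hs hc, e₁]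
  ring

theorem mul_exp_I_add_mul_ne {a b t : ℝ} (h : ∀ m : ℤ, b * t ≠ 2 * Real.pi * m) {z : ℂ}
    (hz : z ≠ 0) :
    z * Complex.exp (Complex.I * ((a + b : ℝ) : ℂ) * (t : ℂ)) ≠
      z * Complex.exp (Complex.I * (a : ℂ) * (t : ℂ)) := by
  intro heq
  obtain ⟨m, hm⟩ := Complex.exp_eq_exp_iff_exists_int.mp (mul_left_cancel₀ hz heq)
  refine h m ?_
  have : Complex.I * ((b * t : ℝ) : ℂ) = Complex.I * ((2 * Real.pi * m : ℝ) : ℂ) := by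
    push_cast at hm ⊢
    linear_combination hm
  exact_mod_cast mul_left_cancel₀ Complex.I_ne_zero this

/-- perturbing the actions by `α/k` at index `k` shifts the limit of the
frequencies: `ω_n^{(4)}(γ^k) → ω_n^{(4)}(γ) + nα`.  Consequently, for `nαt ∉ 2πℤ` and
`z ≠ 0`, the phases `z e^{i ω_n^{(4)}(γ^k) t}` converge to `z e^{i(ω_n^{(4)}(γ)+nα)t}`,
which differs from `z e^{i ω_n^{(4)}(γ) t}`. -/
theorem omega4_update_tendsto (γ : ℕ → ℝ) (hγ : ∀ p, 0 ≤ γ p)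
    (hsum : Summable fun p : ℕ => (p : ℝ) * γ p) (α : ℝ) (hα : 0 < α) :
    ∀ n : ℕ, 1 ≤ n →
      Filter.Tendsto (fun k : ℕ => omega4 (Function.update γ k (γ k + α / k)) n)
        Filter.atTop (nhds (omega4 γ n + n * α)) ∧
      ∀ t : ℝ, (∀ m : ℤ, (n : ℝ) * α * t ≠ 2 * Real.pi * m) → ∀ z : ℂ, z ≠ 0 →
        Filter.Tendsto
          (fun k : ℕ => z * Complex.exp
            (Complex.I * (omega4 (Function.update γ k (γ k + α / k)) n : ℝ) * (t : ℂ)))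
          Filter.atTop
          (nhds (z * Complex.exp (Complex.I * ((omega4 γ n + n * α : ℝ) : ℂ) * (t : ℂ)))) ∧
        z * Complex.exp (Complex.I * ((omega4 γ n + n * α : ℝ) : ℂ) * (t : ℂ)) ≠
          z * Complex.exp (Complex.I * (omega4 γ n : ℝ) * (t : ℂ)) := by
  intro n _
  have hlim := tendsto_omega4_update hγ hsum α n
  refine ⟨hlim, fun t ht z hz => ⟨?_, mul_exp_I_add_mul_ne ht hz⟩⟩
  have hcont : Continuous fun x : ℝ =>
      z * Complex.exp (Complex.I * (x : ℂ) * (t : ℂ)) := by fun_prop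
  exact (hcont.tendsto _).comp hlim
end

section
/- Let ζ=(ζ_n)_{n≥1} be a complex sequence with ∑_{n≥1} n|ζ_n|² < ∞ and let c∈ℝ. Then the set {n≥1 : ζ_n ≠ 0 and ω_n^{(4)}(ζ) = c·n} is finite. (In Birkhoff coordinates this says that every traveling wave solution of the third-order Benjamin–Ono equation is a finite gap potential.) -/
lemma omega4_ge {γ : ℕ → ℝ} (hγ : ∀ p, 0 ≤ γ p) (hs : Summable fun p : ℕ => (p : ℝ) * γ p)
    (n : ℕ) : (n : ℝ) ^ 3 - 2 * n * ∑' p : ℕ, (p : ℝ) * γ p ≤ omega4 γ n := by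
  have hle (p : ℕ) : ((min p n : ℕ) : ℝ) ^ 2 * γ p ≤ n * (p * γ p) := by
    have h₁ : ((min p n : ℕ) : ℝ) ≤ p := by exact_mod_cast min_le_left p n
    have h₂ : ((min p n : ℕ) : ℝ) ≤ n := by exact_mod_cast min_le_right p n
    rw [← mul_assoc, pow_two]
    exact mul_le_mul_of_nonneg_right (mul_le_mul h₂ h₁ (by positivity) (by positivity)) (hγ p)
  have hn := hs.mul_left (n : ℝ)
  have hmin : ∑' p : ℕ, ((min p n : ℕ) : ℝ) ^ 2 * γ p ≤ n * ∑' p : ℕ, (p : ℝ) * γ p := by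
    rw [← tsum_mul_left]
    exact (hn.of_nonneg_of_le (fun p => mul_nonneg (by positivity) (hγ p)) hle).tsum_le_tsum hle hn
  have hdouble : 0 ≤ ∑' pq : ℕ × ℕ,
      ((min (min pq.1 pq.2) n : ℕ) : ℝ) * γ pq.1 * γ pq.2 :=
    tsum_nonneg fun pq => mul_nonneg (mul_nonneg (Nat.cast_nonneg _) (hγ _)) (hγ _)
  unfold omega4
  linarith

/-- for `ζ ∈ h^{1/2}_+` and any speed `c`, the set of indices `n ≥ 1`
with `ζ_n ≠ 0` and `ω_n^{(4)}(ζ) = c n` is finite: every traveling wave of the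
third-order Benjamin–Ono equation is a finite gap potential. -/
theorem travelingWave_finite_gap (ζ : ℕ → ℂ)
    (hζ : Summable fun n : ℕ => (n : ℝ) * ‖ζ n‖ ^ 2) (c : ℝ) :
    {n : ℕ | 1 ≤ n ∧ ζ n ≠ 0 ∧ omega4 (fun p => ‖ζ p‖ ^ 2) n = c * n}.Finite := by
  set S : ℝ := ∑' p : ℕ, (p : ℝ) * ‖ζ p‖ ^ 2 with hS
  refine (Set.finite_Iic ⌊c + 2 * S⌋₊).subset ?_
  rintro n ⟨hn, -, hω⟩
  have hbound := omega4_ge (γ := fun p => ‖ζ p‖ ^ 2) (fun p => by positivity) hζ n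
  rw [hω, ← hS] at hbound
  have hn' : (1 : ℝ) ≤ n := by exact_mod_cast hn
  have hsq : (n : ℝ) ^ 2 ≤ c + 2 * S :=
    le_of_mul_le_mul_left (by linarith) (zero_lt_one.trans_le hn')
  exact Nat.le_floor (by nlinarith)
end

section
/- Let 1≤p<q be integers and let γ=(γ_n)_{n≥1} be nonnegative reals supported on {p,q} with γ_p>0 and γ_q>0. Then q·ω_p^{(4)}(γ) = p·ω_q^{(4)}(γ) (the two-gap traveling wave condition) holds if and only if 0 < γ_p < (1/2)·(p + √(p² + 4q(p+q)/3)) and γ_q = (q(p+q)/3 + p γ_p − γ_p²)/(2γ_p + q). -/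
/-- For actions supported on `{p, q}` the series defining `ω_n^{(4)}` are finite sums. -/
theorem omega4_of_support_pair {p q : ℕ} (hpq : p ≠ q) {γ : ℕ → ℝ}
    (hsupp : ∀ n, n ≠ p → n ≠ q → γ n = 0) (n : ℕ) :
    omega4 γ n = (n : ℝ) ^ 3 + n * (p * γ p + q * γ q)
      - 3 * (((min p n : ℕ) : ℝ) ^ 2 * γ p + ((min q n : ℕ) : ℝ) ^ 2 * γ q)
      + 3 * (((min p n : ℕ) : ℝ) * γ p ^ 2 + 2 * ((min (min p q) n : ℕ) : ℝ) * γ p * γ q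
        + ((min q n : ℕ) : ℝ) * γ q ^ 2) := by
  have hzero : ∀ m ∉ ({p, q} : Finset ℕ), γ m = 0 := fun m hm => by
    simp only [Finset.mem_insert, Finset.mem_singleton, not_or] at hm
    exact hsupp m hm.1 hm.2
  have hsum : ∀ f : ℕ → ℝ, ∑' m, f m * γ m = f p * γ p + f q * γ q := fun f => by
    rw [tsum_eq_sum (s := {p, q}) (fun m hm => by rw [hzero m hm, mul_zero]),
      Finset.sum_pair hpq]
  have hsum₂ : ∑' ab : ℕ × ℕ, ((min (min ab.1 ab.2) n : ℕ) : ℝ) * γ ab.1 * γ ab.2 =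
      ((min p n : ℕ) : ℝ) * γ p ^ 2 + 2 * ((min (min p q) n : ℕ) : ℝ) * γ p * γ q
        + ((min q n : ℕ) : ℝ) * γ q ^ 2 := by
    rw [tsum_eq_sum (s := {p, q} ×ˢ {p, q}), Finset.sum_product, Finset.sum_pair hpq,
      Finset.sum_pair hpq, Finset.sum_pair hpq, min_self, min_self, min_comm q p]
    · ring
    · rintro ⟨a, b⟩ hab
      rw [Finset.mem_product, not_and_or] at hab
      rcases hab with h | h
      · simp [hzero a h]
      · simp [hzero b h]
  rw [omega4, hsum (fun m => (m : ℝ)), hsum (fun m => ((min m n : ℕ) : ℝ) ^ 2), hsum₂]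

/-- classification of the two gap traveling waves.  A two gap potential
with gaps `γ_p, γ_q > 0` at indices `p < q` is a traveling wave
(`ω_p^{(4)}/p = ω_q^{(4)}/q`) iff
`0 < γ_p < (p + √(p² + 4q(p+q)/3))/2` and `γ_q = (q(p+q)/3 + pγ_p − γ_p²)/(2γ_p + q)`. -/
theorem twoGap_travelingWave_iff (p q : ℕ) (hp : 1 ≤ p) (hpq : p < q)
    (γ : ℕ → ℝ) (hγ : ∀ n, 0 ≤ γ n)
    (hsupp : ∀ n, n ≠ p → n ≠ q → γ n = 0)
    (hγp : 0 < γ p) (hγq : 0 < γ q) :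
    (q : ℝ) * omega4 γ p = (p : ℝ) * omega4 γ q ↔
      (0 < γ p ∧
        γ p < (1 / 2) * ((p : ℝ) + Real.sqrt ((p : ℝ) ^ 2 + 4 * q * ((p : ℝ) + q) / 3)) ∧
        γ q = ((q : ℝ) * ((p : ℝ) + q) / 3 + (p : ℝ) * γ p - γ p ^ 2) / (2 * γ p + q)) := by
  have hp₀ : (0 : ℝ) < p := by exact_mod_cast hp
  have hlt : (p : ℝ) < q := by exact_mod_cast hpq
  have hden : 0 < 2 * γ p + (q : ℝ) := by linarith
  have hdiff : (q : ℝ) * omega4 γ p - p * omega4 γ q =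
      3 * p * (q - p) *
        (γ q * (2 * γ p + q) - ((q : ℝ) * (p + q) / 3 + p * γ p - γ p ^ 2)) := by
    rw [omega4_of_support_pair hpq.ne hsupp, omega4_of_support_pair hpq.ne hsupp]
    simp only [min_self, min_eq_left hpq.le, min_eq_right hpq.le]
    ring
  have hcoef : 3 * (p : ℝ) * (q - p) ≠ 0 :=
    mul_ne_zero (by positivity) (sub_ne_zero.mpr hlt.ne')
  have hiff : (q : ℝ) * omega4 γ p = p * omega4 γ q ↔
      γ q = ((q : ℝ) * (p + q) / 3 + p * γ p - γ p ^ 2) / (2 * γ p + q) := by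
    rw [← sub_eq_zero, hdiff, mul_eq_zero_iff_left hcoef, sub_eq_zero, eq_div_iff hden.ne']
  rw [hiff]
  refine ⟨fun h => ⟨hγp, ?_, h⟩, fun h => h.2.2⟩
  have hpos := mul_pos hγq hden
  rw [(eq_div_iff hden.ne').mp h] at hpos
  have hroot : 2 * γ p - p < Real.sqrt ((p : ℝ) ^ 2 + 4 * q * ((p : ℝ) + q) / 3) :=
    Real.lt_sqrt_of_sq_lt (by linarith)
  linarith
end

section
/- Let γ=(γ_n)_{n≥1} be nonnegative reals with finite support, let p be the smallest and q the second smallest element of the support (so p<q, γ_p>0, γ_q>0, and the support has at least two elements), and set Γ = ∑_{n>q} γ_n. If q·ω_p^{(4)}(γ) = p·ω_q^{(4)}(γ), then (q + 2γ_p)·(γ_q + Γ) = q(p+q)/3 + p γ_p − γ_p², and consequently γ_q + Γ < (p+q)/3. -/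
/-- Value of `omega4` at `n ∈ [p, q]` for a finitely supported `γ` whose support lies in
`{p} ∪ [q, ∞)`, in terms of the total mass `T` and the mass `S` of `γ` on `[q, ∞)`. -/
lemma omega4_eq_of_mem_Icc {γ : ℕ → ℝ} (hγ : ∀ n, 0 ≤ γ n) {p q n : ℕ} {S T : ℝ}
    (hmin : ∀ x, γ x ≠ 0 → x = p ∨ q ≤ x) (hpq : p < q) (hpn : p ≤ n) (hnq : n ≤ q)
    (hS : HasSum (fun x => if q ≤ x then γ x else 0) S) (hT : HasSum γ T) :
    omega4 γ n = (n : ℝ) ^ 3 + n * (∑' x : ℕ, (x : ℝ) * γ x)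
      - 3 * ((p : ℝ) ^ 2 * T + ((n : ℝ) ^ 2 - (p : ℝ) ^ 2) * S)
      + 3 * (p * (T * T) + ((n : ℝ) - p) * (S * S)) := by
  have hsq : HasSum (fun x : ℕ => ((min x n : ℕ) : ℝ) ^ 2 * γ x)
      ((p : ℝ) ^ 2 * T + ((n : ℝ) ^ 2 - (p : ℝ) ^ 2) * S) := by
    refine ((hT.mul_left ((p : ℝ) ^ 2)).add
      (hS.mul_left ((n : ℝ) ^ 2 - (p : ℝ) ^ 2))).congr_fun fun x => ?_
    by_cases hx : γ x = 0
    · simp [hx]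
    rcases hmin x hx with rfl | hqx
    · simp [hpn, hpq.not_ge]
    · simp only [hqx, if_true, min_eq_right (hnq.trans hqx)]
      ring
  have hS0 : ∀ x, 0 ≤ if q ≤ x then γ x else 0 := fun x => by
    split_ifs
    exacts [hγ x, le_rfl]
  have hpair : HasSum
      (fun xy : ℕ × ℕ => ((min (min xy.1 xy.2) n : ℕ) : ℝ) * γ xy.1 * γ xy.2)
      (p * (T * T) + ((n : ℝ) - p) * (S * S)) := by
    refine (((hT.mul hT (hT.summable.mul_of_nonneg hT.summable hγ hγ)).mul_left (p : ℝ)).add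
      ((hS.mul hS (hS.summable.mul_of_nonneg hS.summable hS0 hS0)).mul_left
        ((n : ℝ) - p))).congr_fun ?_
    rintro ⟨x, y⟩
    by_cases hx : γ x = 0
    · simp [hx]
    by_cases hy : γ y = 0
    · simp [hy]
    rcases hmin x hx with rfl | hqx
    · have hxy : x ≤ y := by rcases hmin y hy with rfl | hqy <;> omega
      simp only [min_eq_left hxy, min_eq_left hpn, hpq.not_ge, if_false]
      ring
    rcases hmin y hy with rfl | hqy
    · simp only [min_eq_right (hpq.le.trans hqx), min_eq_left hpn, hpq.not_ge, if_false]
      ring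
    · simp only [min_eq_right (hnq.trans (le_min hqx hqy)), hqx, hqy, if_true]
      ring
  rw [omega4, hsq.tsum_eq, hpair.tsum_eq]

/-- if `γ` has finite support with smallest element `p` and second smallest
element `q`, and the speeds of the modes `p` and `q` agree, then with
`Γ = ∑_{n>q} γ_n` one has `(q + 2γ_p)(γ_q + Γ) = q(p+q)/3 + pγ_p − γ_p²`, and
consequently `γ_q + Γ < (p+q)/3`. -/
theorem twoSmallest_speed_eq (γ : ℕ → ℝ) (hγ : ∀ n, 0 ≤ γ n) (h0 : γ 0 = 0)
    (hfin : (Function.support γ).Finite)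
    (p q : ℕ) (hp : γ p ≠ 0) (hq : γ q ≠ 0) (hpq : p < q)
    (hmin : ∀ n, γ n ≠ 0 → n = p ∨ q ≤ n)
    (h : (q : ℝ) * omega4 γ p = (p : ℝ) * omega4 γ q) :
    ((q : ℝ) + 2 * γ p) * (γ q + ∑' n : ℕ, if q < n then γ n else 0)
        = (q : ℝ) * ((p : ℝ) + q) / 3 + (p : ℝ) * γ p - γ p ^ 2 ∧
      γ q + (∑' n : ℕ, if q < n then γ n else 0) < ((p : ℝ) + q) / 3 := by
  have hp0 : p ≠ 0 := fun h => hp (h ▸ h0)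
  have hsum : Summable γ := summable_of_hasFiniteSupport hfin
  have hΓ : HasSum (fun n => if q < n then γ n else 0) (∑' n, if q < n then γ n else 0) :=
    (hsum.of_nonneg_of_le (fun n => by split_ifs; exacts [hγ n, le_rfl])
      (fun n => by split_ifs; exacts [le_rfl, hγ n])).hasSum
  set G := ∑' n : ℕ, if q < n then γ n else 0
  have hS : HasSum (fun n => if q ≤ n then γ n else 0) (γ q + G) := by
    refine ((hasSum_ite_eq q (γ q)).add hΓ).congr_fun fun n => ?_
    rcases lt_trichotomy n q with hn | rfl | hn
    · simp [hn.not_ge, hn.not_gt, hn.ne]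
    · simp
    · simp [hn, hn.le, hn.ne']
  have hT : HasSum γ (γ p + (γ q + G)) := by
    refine ((hasSum_ite_eq p (γ p)).add hS).congr_fun fun n => ?_
    rcases eq_or_ne n p with rfl | hn
    · simp [hpq.not_ge]
    by_cases hqn : q ≤ n
    · simp [hn, hqn]
    · have : γ n = 0 := by_contra fun h => (hmin n h).elim hn hqn
      simp [hn, hqn, this]
  rw [omega4_eq_of_mem_Icc hγ hmin hpq le_rfl hpq.le hS hT,
    omega4_eq_of_mem_Icc hγ hmin hpq hpq.le le_rfl hS hT] at h
  generalize γ q + G = S at h ⊢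
  have ha : 0 < γ p := (hγ p).lt_of_ne' hp
  have hpR : (0 : ℝ) < p := by positivity
  have hpqR : (p : ℝ) < q := by exact_mod_cast hpq
  have key : ((q : ℝ) + 2 * γ p) * S
      = (q : ℝ) * ((p : ℝ) + q) / 3 + (p : ℝ) * γ p - γ p ^ 2 := by
    refine mul_left_cancel₀ (mul_pos hpR (sub_pos.2 hpqR)).ne' ?_
    linear_combination h / 3
  refine ⟨key, lt_of_mul_lt_mul_left (a := (q : ℝ) + 2 * γ p) ?_ (by positivity)⟩
  rw [key]
  nlinarith [mul_pos ha ha, mul_pos ha (sub_pos.2 hpqR), mul_pos ha hpR]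
end

section
/- Let 1≤p<q<r be integers and let γ=(γ_n)_{n≥1} be nonnegative reals supported on {p,q,r} with γ_p>0, γ_q>0 and γ_r>0. Then it is NOT the case that both q·ω_p^{(4)}(γ) = p·ω_q^{(4)}(γ) and r·ω_p^{(4)}(γ) = p·ω_r^{(4)}(γ). (There are no three gap traveling waves for the third-order Benjamin–Ono equation.) -/
/-- The value of `omega4` on actions supported on three indices. -/
theorem omega4_eq_of_support {p q r : ℕ} (hpq : p < q) (hqr : q < r) {γ : ℕ → ℝ}
    (hsupp : ∀ n, n ≠ p → n ≠ q → n ≠ r → γ n = 0) (n : ℕ) :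
    omega4 γ n = (n : ℝ) ^ 3 + n * (p * γ p + q * γ q + r * γ r)
      - 3 * (((min p n : ℕ) : ℝ) ^ 2 * γ p + ((min q n : ℕ) : ℝ) ^ 2 * γ q
        + ((min r n : ℕ) : ℝ) ^ 2 * γ r)
      + 3 * (((min p n : ℕ) : ℝ) * (γ p ^ 2 + 2 * γ p * (γ q + γ r))
        + ((min q n : ℕ) : ℝ) * (γ q ^ 2 + 2 * γ q * γ r)
        + ((min r n : ℕ) : ℝ) * γ r ^ 2) := by
  have hpr := hpq.trans hqr
  have hzero : ∀ m ∉ ({p, q, r} : Finset ℕ), γ m = 0 := fun m hm => by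
    simp only [Finset.mem_insert, Finset.mem_singleton, not_or] at hm
    exact hsupp m hm.1 hm.2.1 hm.2.2
  have hsum (f : ℕ → ℝ) : ∑ m ∈ ({p, q, r} : Finset ℕ), f m = f p + f q + f r := by
    rw [Finset.sum_insert (by simp [hpq.ne, hpr.ne]), Finset.sum_pair hqr.ne, add_assoc]
  have hpair : ∀ x ∉ ({p, q, r} : Finset ℕ) ×ˢ ({p, q, r} : Finset ℕ),
      ((min (min x.1 x.2) n : ℕ) : ℝ) * γ x.1 * γ x.2 = 0 := fun x hx => by
    rw [Finset.mem_product, not_and_or] at hx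
    rcases hx with hx | hx <;> simp [hzero _ hx]
  unfold omega4
  rw [tsum_eq_sum (s := {p, q, r}) fun m hm => by rw [hzero m hm, mul_zero],
    tsum_eq_sum (s := {p, q, r}) fun m hm => by rw [hzero m hm, mul_zero],
    tsum_eq_sum hpair, Finset.sum_product]
  simp only [hsum, min_self, min_eq_left hpq.le, min_eq_right hpq.le, min_eq_left hqr.le,
    min_eq_right hqr.le, min_eq_left hpr.le, min_eq_right hpr.le]
  ring

/-- there are no three gap traveling waves: a potential with exactly
three nonzero gaps `γ_p, γ_q, γ_r` at indices `p < q < r` cannot have all three speeds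
`ω_n^{(4)}/n` equal. -/
theorem no_threeGap_travelingWave (p q r : ℕ) (hp : 1 ≤ p) (hpq : p < q) (hqr : q < r)
    (γ : ℕ → ℝ) (hγ : ∀ n, 0 ≤ γ n)
    (hsupp : ∀ n, n ≠ p → n ≠ q → n ≠ r → γ n = 0)
    (hγp : 0 < γ p) (hγq : 0 < γ q) (hγr : 0 < γ r) :
    ¬ ((q : ℝ) * omega4 γ p = (p : ℝ) * omega4 γ q ∧
        (r : ℝ) * omega4 γ p = (p : ℝ) * omega4 γ r) := by
  rintro ⟨h₁, h₂⟩
  have hpr := hpq.trans hqr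
  simp only [omega4_eq_of_support hpq hqr hsupp, min_self, min_eq_left hpq.le,
    min_eq_right hpq.le, min_eq_left hqr.le, min_eq_right hqr.le, min_eq_left hpr.le,
    min_eq_right hpr.le] at h₁ h₂
  have hp₀ : (0 : ℝ) < p := by exact_mod_cast hp
  have hpq' : (p : ℝ) < q := by exact_mod_cast hpq
  have hqr' : (q : ℝ) < r := by exact_mod_cast hqr
  generalize (p : ℝ) = P, (q : ℝ) = Q, (r : ℝ) = R, γ p = a, γ q = b, γ r = c at *
  have hQ₀ : 0 < Q := hp₀.trans hpq'
  have e₁ : 3 * a ^ 2 + 6 * a * (b + c) + 3 * Q * (b + c) - 3 * P * a - Q * (P + Q) = 0 := by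
    have h : P * (Q - P) ≠ 0 := (mul_pos hp₀ (sub_pos.2 hpq')).ne'
    apply mul_left_cancel₀ h
    linear_combination h₁
  have e₂ : 3 * b ^ 2 + 6 * b * c + 3 * (R - P) * c - 3 * (P + Q) * b
      - (R - P) * (P + Q + R) = 0 := by
    have h : P * (R - Q) * Q ≠ 0 :=
      (mul_pos (mul_pos hp₀ (sub_pos.2 hqr')) hQ₀).ne'
    apply mul_left_cancel₀ h
    linear_combination Q * h₂ - R * h₁ - P * (R - Q) * P * e₁
  have hs : 3 * (b + c) < P + Q := by
    have h : 0 < 2 * a + Q := by linarith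
    refine lt_of_mul_lt_mul_left ?_ h.le
    nlinarith [mul_pos hγp hQ₀, mul_pos hγp (sub_pos.2 hpq'), mul_pos hγp hγp]
  have hb : b * (b + 2 * c) < b * (P + Q) :=
    mul_lt_mul_of_pos_left (by linarith) hγq
  have hc : (R - P) * (3 * c) < (R - P) * (P + Q + R) :=
    mul_lt_mul_of_pos_left (by linarith) (by linarith)
  linarith
end

section
/- Let γ=(γ_n)_{n≥1} be nonnegative reals with finite support of cardinality at least 3, and positive on its support. Then it is NOT the case that m·ω_n^{(4)}(γ) = n·ω_m^{(4)}(γ) for all n, m in the support of γ. (There are no N gap traveling waves of the third-order Benjamin–Ono equation for N≥3.) -/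
open Finset in
/-- The increments of `omega4` are, up to a constant, squares of the strictly increasing
sequence `n + 1/2 - ∑_{p > n} γ_p`. -/
lemma omega4_succ (γ : ℕ → ℝ) (s : Finset ℕ) (hs : ∀ p ∉ s, γ p = 0) (n : ℕ) :
    omega4 γ (n + 1) = omega4 γ n + (∑ p ∈ s, (p : ℝ) * γ p + 1 / 4
      + 3 * ((n : ℝ) + 1 / 2 - ∑ p ∈ s, if n < p then γ p else 0) ^ 2) := by
  have h_linear : ∑' p : ℕ, (p : ℝ) * γ p = ∑ p ∈ s, (p : ℝ) * γ p :=
    tsum_eq_sum fun p hp => by simp [hs p hp]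
  have h_square (k : ℕ) : ∑' p : ℕ, ((min p k : ℕ) : ℝ) ^ 2 * γ p
      = ∑ p ∈ s, ((min p k : ℕ) : ℝ) ^ 2 * γ p :=
    tsum_eq_sum fun p hp => by simp [hs p hp]
  have h_pair (k : ℕ) :
      ∑' pq : ℕ × ℕ, ((min (min pq.1 pq.2) k : ℕ) : ℝ) * γ pq.1 * γ pq.2
      = ∑ p ∈ s, ∑ q ∈ s, ((min (min p q) k : ℕ) : ℝ) * γ p * γ q := by
    rw [← sum_product' s s fun p q => ((min (min p q) k : ℕ) : ℝ) * γ p * γ q]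
    refine tsum_eq_sum fun pq hpq => ?_
    rw [mem_product, not_and_or] at hpq
    rcases hpq with h | h <;> simp [hs _ h]
  have h_square_succ : ∑ p ∈ s, ((min p (n + 1) : ℕ) : ℝ) ^ 2 * γ p
      = ∑ p ∈ s, ((min p n : ℕ) : ℝ) ^ 2 * γ p
        + (2 * n + 1) * ∑ p ∈ s, if n < p then γ p else 0 := by
    rw [mul_sum, ← sum_add_distrib]
    refine sum_congr rfl fun p _ => ?_
    split_ifs with h
    · rw [min_eq_right (by lia : n + 1 ≤ p), min_eq_right h.le]
      push_cast
      ring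
    · rw [min_eq_left (by lia : p ≤ n + 1), min_eq_left (by lia : p ≤ n)]
      ring
  have h_pair_succ : ∑ p ∈ s, ∑ q ∈ s, ((min (min p q) (n + 1) : ℕ) : ℝ) * γ p * γ q
      = ∑ p ∈ s, ∑ q ∈ s, ((min (min p q) n : ℕ) : ℝ) * γ p * γ q
        + (∑ p ∈ s, if n < p then γ p else 0) ^ 2 := by
    rw [sq, sum_mul_sum, ← sum_add_distrib]
    refine sum_congr rfl fun p _ => ?_
    rw [← sum_add_distrib]
    refine sum_congr rfl fun q _ => ?_
    by_cases h : n < min p q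
    · obtain ⟨hp, hq⟩ := lt_min_iff.1 h
      rw [min_eq_right (Nat.succ_le_of_lt h), min_eq_right h.le, if_pos hp, if_pos hq]
      push_cast
      ring
    · rw [min_eq_left (by lia : min p q ≤ n + 1), min_eq_left (not_lt.1 h)]
      rw [lt_min_iff, not_and_or] at h
      rcases h with h | h <;> simp [h]
  simp only [omega4, h_linear, h_square, h_pair, h_square_succ, h_pair_succ]
  push_cast
  ring

/-- The square of a strictly monotone sequence, up to an affine change, cannot have the same
average `c` on three consecutive blocks. -/
lemma not_sum_range_sq_eq_mul {x : ℕ → ℝ} (hx : StrictMono x) (A c : ℝ) {a b d : ℕ}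
    (ha : 0 < a) (hab : a < b) (hbd : b < d) :
    ¬ (∀ n ∈ ({a, b, d} : Set ℕ), ∑ k ∈ Finset.range n, (A + 3 * x k ^ 2) = n * c) := by
  intro h
  have h_a := h a (by simp)
  have h_b := h b (by simp)
  have h_d := h d (by simp)
  obtain ⟨i, hi, hic⟩ : ∃ i ∈ Finset.range a, A + 3 * x i ^ 2 ≤ c :=
    Finset.exists_le_of_sum_le ⟨0, by simpa using ha⟩ (by simp [h_a])
  obtain ⟨j, hj, hjc⟩ : ∃ j ∈ Finset.Ico b d, A + 3 * x j ^ 2 ≤ c := by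
    refine Finset.exists_le_of_sum_le (by simpa using hbd) ?_
    rw [Finset.sum_Ico_eq_sub _ hbd.le, h_b, h_d]
    simp [Nat.cast_sub hbd.le, sub_mul]
  have h_lt : ∑ k ∈ Finset.Ico a b, (A + 3 * x k ^ 2) < ∑ _k ∈ Finset.Ico a b, c := by
    refine Finset.sum_lt_sum_of_nonempty (by simpa using hab) fun k hk => ?_
    rw [Finset.mem_range] at hi
    rw [Finset.mem_Ico] at hj hk
    have hik : x i < x k := hx (by lia)
    have hkj : x k < x j := hx (by lia)
    rcases le_total 0 (x k) with h0 | h0 <;> nlinarith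
  rw [Finset.sum_Ico_eq_sub _ hab.le, h_a, h_b] at h_lt
  simp [Nat.cast_sub hab.le, sub_mul] at h_lt

/-- there are no `N` gap traveling waves for `N ≥ 3`: if `γ` has finite
support of cardinality at least `3`, the speeds `ω_n^{(4)}/n` cannot agree for all
indices `n` in the support of `γ`. -/
theorem no_NGap_travelingWave (γ : ℕ → ℝ) (hγ : ∀ n, 0 ≤ γ n) (h0 : γ 0 = 0)
    (hfin : (Function.support γ).Finite) (hcard : 3 ≤ hfin.toFinset.card) :
    ¬ (∀ n ∈ Function.support γ, ∀ m ∈ Function.support γ,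
        (m : ℝ) * omega4 γ n = (n : ℝ) * omega4 γ m) := by
  intro h
  set s := hfin.toFinset
  have hs : ∀ p ∉ s, γ p = 0 := fun p hp => by simpa [s] using hp
  set e := s.orderEmbOfCardLe hcard
  have he (i : Fin 3) : e i ∈ Function.support γ := by
    simpa [s] using s.orderEmbOfCardLe_mem hcard i
  have h_pos : 0 < e 0 := Nat.pos_of_ne_zero fun hz => he 0 (by rw [hz, h0])
  have h_mono : StrictMono fun k : ℕ => (k : ℝ) + 1 / 2 - ∑ p ∈ s, if k < p then γ p else 0 := by
    refine strictMono_nat_of_lt_succ fun k => ?_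
    have h_tail : (∑ p ∈ s, if k + 1 < p then γ p else 0) ≤ ∑ p ∈ s, if k < p then γ p else 0 := by
      refine Finset.sum_le_sum fun p _ => ?_
      split_ifs <;> first | lia | simp [hγ]
    push_cast
    linarith
  have h_sum (n : ℕ) : ∑ k ∈ Finset.range n, (∑ p ∈ s, (p : ℝ) * γ p + 1 / 4
      + 3 * ((k : ℝ) + 1 / 2 - ∑ p ∈ s, if k < p then γ p else 0) ^ 2) = omega4 γ n := by
    induction n with
    | zero => simp [omega4]
    | succ n ih => rw [Finset.sum_range_succ, ih, omega4_succ γ s hs]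
  refine not_sum_range_sq_eq_mul h_mono (∑ p ∈ s, (p : ℝ) * γ p + 1 / 4)
    (omega4 γ (e 0) / e 0) h_pos (e.strictMono (by decide : (0 : Fin 3) < 1))
    (e.strictMono (by decide : (1 : Fin 3) < 2)) fun n hn => ?_
  have hn_supp : n ∈ Function.support γ := by
    rcases hn with rfl | rfl | rfl <;> exact he _
  have h_ne : ((e 0 : ℕ) : ℝ) ≠ 0 := by exact_mod_cast h_pos.ne'
  rw [h_sum, mul_div_assoc', eq_div_iff h_ne, mul_comm]
  exact h n hn_supp _ (he 0)
end

section
/- Let 1≤p<q be integers, let γ=(γ_n)_{n≥1} be nonnegative reals supported on {p,q} with γ_p>0 and γ_q>0, let ε∈ℝ with γ_q+ε≥0, and let γ^ε be obtained from γ by replacing γ_q with γ_q+ε. Then ω_q^{(4)}(γ^ε)/q − ω_p^{(4)}(γ^ε)/p = (ω_q^{(4)}(γ)/q − ω_p^{(4)}(γ)/p) − 3·(q − p + 2(1 − p/q)·γ_p)·ε. In particular, if γ is a two-gap traveling wave (i.e. q·ω_p^{(4)}(γ) = p·ω_q^{(4)}(γ)) and ε≠0, then ω_q^{(4)}(γ^ε)/q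 ≠ ω_p^{(4)}(γ^ε)/p. -/
/-- The frequencies of a potential whose actions are supported on two indices. -/
theorem omega4_eq_of_support_pair {p q : ℕ} (hpq : p < q) {γ : ℕ → ℝ}
    (hsupp : ∀ n, n ≠ p → n ≠ q → γ n = 0) (n : ℕ) :
    omega4 γ n = (n : ℝ) ^ 3 + n * (p * γ p + q * γ q)
      - 3 * (((min p n : ℕ) : ℝ) ^ 2 * γ p + ((min q n : ℕ) : ℝ) ^ 2 * γ q)
      + 3 * (((min p n : ℕ) : ℝ) * (γ p ^ 2 + 2 * γ p * γ q)
        + ((min q n : ℕ) : ℝ) * γ q ^ 2) := by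
  have hzero : ∀ m ∉ ({p, q} : Finset ℕ), γ m = 0 := by
    intro m hm
    simp only [Finset.mem_insert, Finset.mem_singleton, not_or] at hm
    exact hsupp m hm.1 hm.2
  unfold omega4
  rw [tsum_eq_sum (s := {p, q}) (fun m hm => by rw [hzero m hm, mul_zero]),
    tsum_eq_sum (s := {p, q}) (fun m hm => by rw [hzero m hm, mul_zero]),
    tsum_eq_sum (s := ({p, q} : Finset ℕ) ×ˢ {p, q}), Finset.sum_product]
  · simp only [Finset.sum_pair hpq.ne, min_self, min_eq_left hpq.le, min_eq_right hpq.le]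
    ring
  · intro m hm
    rw [Finset.mem_product, not_and_or] at hm
    rcases hm with hm | hm <;> simp [hzero _ hm]

/-- perturbing the action `γ_q` of a two gap potential by `ε` changes the
difference of the speeds by `−3(q − p + 2(1 − p/q)γ_p)ε`; in particular, a perturbed
two gap traveling wave with `ε ≠ 0` is no longer a traveling wave. -/
theorem twoGap_speed_difference_perturbation (p q : ℕ) (hp : 1 ≤ p) (hpq : p < q)
    (γ : ℕ → ℝ) (hγ : ∀ n, 0 ≤ γ n)
    (hsupp : ∀ n, n ≠ p → n ≠ q → γ n = 0)
    (hγp : 0 < γ p) (hγq : 0 < γ q)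
    (ε : ℝ) (hε : 0 ≤ γ q + ε) :
    (omega4 (Function.update γ q (γ q + ε)) q / q
          - omega4 (Function.update γ q (γ q + ε)) p / p
        = (omega4 γ q / q - omega4 γ p / p)
          - 3 * ((q : ℝ) - p + 2 * (1 - (p : ℝ) / q) * γ p) * ε) ∧
      ((q : ℝ) * omega4 γ p = (p : ℝ) * omega4 γ q → ε ≠ 0 →
        omega4 (Function.update γ q (γ q + ε)) q / q ≠
          omega4 (Function.update γ q (γ q + ε)) p / p) := by
  have hp0 : (0 : ℝ) < p := by exact_mod_cast hp
  have hpq' : (p : ℝ) < q := by exact_mod_cast hpq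
  have hq0 : (0 : ℝ) < q := hp0.trans hpq'
  have hsupp' : ∀ n, n ≠ p → n ≠ q → Function.update γ q (γ q + ε) n = 0 := by
    intro n hnp hnq
    rw [Function.update_of_ne hnq, hsupp n hnp hnq]
  have hdiff : omega4 (Function.update γ q (γ q + ε)) q / q
        - omega4 (Function.update γ q (γ q + ε)) p / p
      = (omega4 γ q / q - omega4 γ p / p)
        - 3 * ((q : ℝ) - p + 2 * (1 - (p : ℝ) / q) * γ p) * ε := by
    simp only [omega4_eq_of_support_pair hpq hsupp, omega4_eq_of_support_pair hpq hsupp',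
      Function.update_self, Function.update_of_ne hpq.ne, min_self, min_eq_left hpq.le,
      min_eq_right hpq.le]
    field_simp
    ring
  refine ⟨hdiff, fun hwave hε0 heq => ?_⟩
  have hspeed : omega4 γ q / q - omega4 γ p / p = 0 := by
    rw [sub_eq_zero, div_eq_div_iff hq0.ne' hp0.ne']
    linarith
  have hcoeff : 0 < (q : ℝ) - p + 2 * (1 - (p : ℝ) / q) * γ p := by
    have hratio : 0 < 1 - (p : ℝ) / q := sub_pos.2 ((div_lt_one hq0).2 hpq')
    have hgap : 0 < (q : ℝ) - p := sub_pos.2 hpq'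
    positivity
  rw [heq, sub_self, hspeed, zero_sub, eq_comm, neg_eq_zero] at hdiff
  exact mul_ne_zero (mul_pos three_pos hcoeff).ne' hε0 hdiff
end

section
/- Let p≥1 be an integer and let ζ∈h^{1/2}_+ satisfy ζ_n = 0 for all n≠p and ζ_p ≠ 0. Let ζ^k∈h^{1/2}_+ (k∈ℕ) with ‖ζ^k − ζ‖_{h^{1/2}} → 0 and let (t_k)_k be any sequence of real numbers. Then there exist a strictly increasing sequence of indices (k_j)_j and θ∈ℝ such that ‖(ζ^{k_j}_n·e^{i ω_n^{(4)}(ζ^{k_j}) t_{k_j}})_{n≥1} − ξ‖_{h^{1/2}} → 0 as j→∞, where ξ is the sequence with ξ_p = e^{iθ}·ζ_p and ξ_n = 0 for n≠p. (This is the orbital stability of one gap traveling waves expressed in Birkhoff coordinates.) -/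
/-- Weighted square-summability is stable under differences. -/
theorem summable_weighted_sq_norm_sub {a b : ℕ → ℂ}
    (ha : Summable fun n : ℕ => (n : ℝ) * ‖a n‖ ^ 2)
    (hb : Summable fun n : ℕ => (n : ℝ) * ‖b n‖ ^ 2) :
    Summable fun n : ℕ => (n : ℝ) * ‖a n - b n‖ ^ 2 := by
  refine Summable.of_nonneg_of_le (fun n => by positivity) (fun n => ?_)
    ((ha.mul_left 2).add (hb.mul_left 2))
  have h : ‖a n - b n‖ ^ 2 ≤ 2 * ‖a n‖ ^ 2 + 2 * ‖b n‖ ^ 2 :=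
    calc ‖a n - b n‖ ^ 2 ≤ (‖a n‖ + ‖b n‖) ^ 2 := by gcongr; exact norm_sub_le _ _
      _ ≤ 2 * ‖a n‖ ^ 2 + 2 * ‖b n‖ ^ 2 := by nlinarith [sq_nonneg (‖a n‖ - ‖b n‖)]
  calc (n : ℝ) * ‖a n - b n‖ ^ 2 ≤ (n : ℝ) * (2 * ‖a n‖ ^ 2 + 2 * ‖b n‖ ^ 2) := by gcongr
    _ = 2 * ((n : ℝ) * ‖a n‖ ^ 2) + 2 * ((n : ℝ) * ‖b n‖ ^ 2) := by ring

/-- Multiplying `a` by unimodular factors `u n` moves it away from a rotate by `v` of a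
sequence `b` supported at `p` by at most the distance of `a` to `b` plus the distance of
the phases `u p` and `v`. -/
theorem tsum_weighted_sq_norm_rotate_sub_le {a b u : ℕ → ℂ} {p : ℕ} (v : ℂ)
    (hab : Summable fun n : ℕ => (n : ℝ) * ‖a n - b n‖ ^ 2)
    (hb : ∀ n, 1 ≤ n → n ≠ p → b n = 0) (hu : ∀ n, ‖u n‖ = 1) :
    ∑' n : ℕ, (n : ℝ) * ‖a n * u n - (if n = p then v * b p else 0)‖ ^ 2 ≤
      2 * (∑' n : ℕ, (n : ℝ) * ‖a n - b n‖ ^ 2)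
        + 2 * ((p : ℝ) * (‖u p - v‖ ^ 2 * ‖b p‖ ^ 2)) := by
  set c : ℝ := 2 * ((p : ℝ) * (‖u p - v‖ ^ 2 * ‖b p‖ ^ 2)) with hc
  have hle : ∀ n : ℕ, (n : ℝ) * ‖a n * u n - (if n = p then v * b p else 0)‖ ^ 2 ≤
      2 * ((n : ℝ) * ‖a n - b n‖ ^ 2) + (if n = p then c else 0) := by
    intro n
    by_cases hn : n = p
    · subst hn
      have h1 : ‖a n * u n - v * b n‖ ≤ ‖a n - b n‖ + ‖u n - v‖ * ‖b n‖ :=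
        calc ‖a n * u n - v * b n‖ = ‖(a n - b n) * u n + (u n - v) * b n‖ := by ring_nf
          _ ≤ ‖(a n - b n) * u n‖ + ‖(u n - v) * b n‖ := norm_add_le _ _
          _ = ‖a n - b n‖ + ‖u n - v‖ * ‖b n‖ := by simp [hu n]
      have h2 : ‖a n * u n - v * b n‖ ^ 2
          ≤ 2 * ‖a n - b n‖ ^ 2 + 2 * (‖u n - v‖ ^ 2 * ‖b n‖ ^ 2) :=
        calc ‖a n * u n - v * b n‖ ^ 2 ≤ (‖a n - b n‖ + ‖u n - v‖ * ‖b n‖) ^ 2 := by gcongr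
          _ ≤ _ := by nlinarith [sq_nonneg (‖a n - b n‖ - ‖u n - v‖ * ‖b n‖)]
      simp only [if_true, hc]
      nlinarith [mul_le_mul_of_nonneg_left h2 (Nat.cast_nonneg (α := ℝ) n)]
    · rcases Nat.eq_zero_or_pos n with rfl | hpos
      · simp [hn]
      · have h : 0 ≤ (n : ℝ) * ‖a n‖ ^ 2 := by positivity
        simp only [hn, if_false, hb n hpos hn, sub_zero, norm_mul, hu n, mul_one, add_zero]
        linarith
  have hsum : Summable fun n : ℕ => if n = p then c else 0 := (hasSum_ite_eq p c).summable
  have hbound := (hab.mul_left 2).add hsum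
  calc _ ≤ ∑' n : ℕ, (2 * ((n : ℝ) * ‖a n - b n‖ ^ 2) + (if n = p then c else 0)) :=
        (Summable.of_nonneg_of_le (fun n => by positivity) hle hbound).tsum_le_tsum hle hbound
    _ = _ := by rw [(hab.mul_left 2).tsum_add hsum, tsum_mul_left, tsum_ite_eq]

/-- Any sequence of unimodular numbers `exp (i a_k)` has a subsequence converging to some
`exp (i θ)`. -/
theorem exists_subseq_tendsto_exp_I_mul (a : ℕ → ℝ) :
    ∃ φ : ℕ → ℕ, StrictMono φ ∧ ∃ θ : ℝ, Filter.Tendsto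
      (fun j => Complex.exp (Complex.I * (a (φ j) : ℂ))) Filter.atTop
      (nhds (Complex.exp (Complex.I * (θ : ℂ)))) := by
  obtain ⟨z, φ, hφ, hz⟩ := CompactSpace.tendsto_subseq fun k => Circle.exp (a k)
  refine ⟨φ, hφ, Complex.arg z, ?_⟩
  have h := (continuous_subtype_val.tendsto z).comp hz
  rw [← Circle.exp_arg z, Circle.coe_exp] at h
  simp only [mul_comm Complex.I]
  exact h

/-- orbital stability of one gap traveling waves in Birkhoff coordinates.
If `ζ` is a one gap potential with gap at index `p`, `ζ^k → ζ` in `h^{1/2}_+` and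
`(t_k)` is any sequence of times, then along a subsequence the flowed data
`(ζ^k_n e^{i ω_n^{(4)}(ζ^k) t_k})_n` converge in `h^{1/2}_+` to a rotate
`(e^{iθ} ζ_p)` of `ζ`. -/
theorem oneGap_orbital_stability (p : ℕ) (hp : 1 ≤ p) (ζ : ℕ → ℂ)
    (hζsum : Summable fun n : ℕ => (n : ℝ) * ‖ζ n‖ ^ 2)
    (hζp : ζ p ≠ 0) (hζ0 : ∀ n, 1 ≤ n → n ≠ p → ζ n = 0)
    (ζk : ℕ → ℕ → ℂ)
    (hζk : ∀ k, Summable fun n : ℕ => (n : ℝ) * ‖ζk k n‖ ^ 2)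
    (hconv : Filter.Tendsto (fun k => ∑' n : ℕ, (n : ℝ) * ‖ζk k n - ζ n‖ ^ 2)
      Filter.atTop (nhds 0))
    (t : ℕ → ℝ) :
    ∃ φ : ℕ → ℕ, StrictMono φ ∧ ∃ θ : ℝ,
      Filter.Tendsto (fun j => ∑' n : ℕ, (n : ℝ) *
          ‖ζk (φ j) n * Complex.exp
              (Complex.I * (omega4 (fun m => ‖ζk (φ j) m‖ ^ 2) n : ℝ) * (t (φ j) : ℂ))
            - (if n = p then Complex.exp (Complex.I * (θ : ℂ)) * ζ p else 0)‖ ^ 2)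
        Filter.atTop (nhds 0) := by
  obtain ⟨φ, hφ, θ, hθ⟩ := exists_subseq_tendsto_exp_I_mul
    fun k => omega4 (fun m => ‖ζk k m‖ ^ 2) p * t k
  refine ⟨φ, hφ, θ, ?_⟩
  have hphase : Filter.Tendsto (fun j => ‖Complex.exp
      (Complex.I * (omega4 (fun m => ‖ζk (φ j) m‖ ^ 2) p : ℝ) * (t (φ j) : ℂ))
        - Complex.exp (Complex.I * (θ : ℂ))‖) Filter.atTop (nhds 0) := by
    simpa [mul_assoc] using tendsto_iff_norm_sub_tendsto_zero.1 hθ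
  have hlim := ((hconv.comp hφ.tendsto_atTop).const_mul 2).add
    ((((hphase.pow 2).mul_const (‖ζ p‖ ^ 2)).const_mul (p : ℝ)).const_mul 2)
  simp only [ne_eq, OfNat.ofNat_ne_zero, not_false_eq_true, zero_pow, zero_mul, mul_zero,
    add_zero] at hlim
  refine squeeze_zero (fun j => tsum_nonneg fun n => by positivity) (fun j => ?_) hlim
  refine tsum_weighted_sq_norm_rotate_sub_le (Complex.exp (Complex.I * (θ : ℂ)))
    (u := fun n => Complex.exp
      (Complex.I * (omega4 (fun m => ‖ζk (φ j) m‖ ^ 2) n : ℝ) * (t (φ j) : ℂ)))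
    (summable_weighted_sq_norm_sub (hζk (φ j)) hζsum) hζ0 fun n => ?_
  rw [mul_assoc, ← Complex.ofReal_mul, Complex.norm_exp_I_mul_ofReal]
end

section
/- Let γ=(γ_p)_{p≥1} be nonnegative reals with finite support and set s_p = ∑_{k≥p} γ_k. Then −s_1³ + ∑_{p≥1} ((p − s_{p+1})³ − (p − s_p)³) = 3·∑_{p≥1} p²·γ_p − 3·∑_{p≥1} s_p², where all sums have only finitely many nonzero terms. -/
/-- Finite form of the cubic summation by parts, with its boundary terms. -/
theorem sum_cube_sub_cube_of_succ (γ S : ℕ → ℝ) (hS : ∀ n, S n = γ n + S (n + 1)) (n : ℕ) :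
    -S 1 ^ 3 + ∑ p ∈ Finset.range n,
        (((p : ℝ) + 1 - S (p + 2)) ^ 3 - ((p : ℝ) + 1 - S (p + 1)) ^ 3) =
      3 * ∑ p ∈ Finset.range n, ((p : ℝ) + 1) ^ 2 * γ (p + 1) -
        3 * ∑ p ∈ Finset.range n, S (p + 1) ^ 2 + 3 * n * S (n + 1) ^ 2 - S (n + 1) ^ 3 := by
  induction n with
  | zero => simp
  | succ n ih =>
    have h : γ (n + 1) = S (n + 1) - S (n + 2) := by linarith [hS (n + 1)]
    simp only [Finset.sum_range_succ, h]
    push_cast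
    linear_combination ih

/-- with `s_p = ∑_{k≥p} γ_k`, the coefficient `P_2` of the generating
function satisfies
`−s_1³ + ∑_{p≥1} ((p − s_{p+1})³ − (p − s_p)³) = 3 ∑_{p≥1} p² γ_p − 3 ∑_{p≥1} s_p²`
(the index `p ≥ 1` is encoded as `p + 1` with `p : ℕ`). -/
theorem P2_identity (γ : ℕ → ℝ) (hγ : ∀ n, 0 ≤ γ n)
    (hfin : (Function.support γ).Finite)
    (S : ℕ → ℝ) (hS : ∀ n, S n = ∑' k : ℕ, if n ≤ k then γ k else 0) :
    -S 1 ^ 3 +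
        (∑' p : ℕ, (((p : ℝ) + 1 - S (p + 2)) ^ 3 - ((p : ℝ) + 1 - S (p + 1)) ^ 3)) =
      3 * (∑' p : ℕ, ((p : ℝ) + 1) ^ 2 * γ (p + 1)) - 3 * ∑' p : ℕ, S (p + 1) ^ 2 := by
  obtain ⟨M, hM⟩ := hfin.bddAbove
  have hzero : ∀ k, M < k → γ k = 0 := fun k hk => by
    by_contra h
    exact absurd (hM h) (by omega)
  have hsum : ∀ n, S n = ∑ k ∈ Finset.range (M + 1), if n ≤ k then γ k else 0 := fun n => by
    rw [hS]
    refine tsum_eq_sum fun k hk => ?_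
    simp [hzero k (by simpa using hk)]
  have hsucc : ∀ n, S n = γ n + S (n + 1) := fun n => by
    have hn : γ n = ∑ k ∈ Finset.range (M + 1), if n = k then γ k else 0 := by
      rw [Finset.sum_ite_eq]
      split_ifs with h
      · rfl
      · exact hzero n (by simpa using h)
    rw [hsum, hsum, hn, ← Finset.sum_add_distrib]
    refine Finset.sum_congr rfl fun k _ => ?_
    rcases lt_trichotomy n k with h | h | h
    · simp [h.le, h.ne, Nat.succ_le_of_lt h]
    · simp [h]
    · simp [h.not_ge, h.ne', show ¬ n + 1 ≤ k by omega]
  have hSzero : ∀ n, M < n → S n = 0 := fun n hn => by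
    rw [hsum]
    refine Finset.sum_eq_zero fun k hk => if_neg ?_
    rw [Finset.mem_range] at hk
    omega
  have hlt : ∀ p, p ∉ Finset.range M → M < p + 1 := fun p hp => by
    rw [Finset.mem_range] at hp
    omega
  rw [tsum_eq_sum (s := Finset.range M) fun p hp => by
      rw [hSzero (p + 1) (hlt p hp), hSzero (p + 2) (by have := hlt p hp; omega), sub_self],
    tsum_eq_sum (s := Finset.range M) fun p hp => by rw [hzero _ (hlt p hp), mul_zero],
    tsum_eq_sum (s := Finset.range M) fun p hp => by rw [hSzero _ (hlt p hp), zero_pow two_ne_zero],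
    sum_cube_sub_cube_of_succ γ S hsucc, hSzero (M + 1) (by omega)]
  ring
end
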